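/- arXiv:1111.6418 — 4 statements merged into one kernel-verified Lean document; each statement's English description precedes it below -/
import Mathlib

section
/- For n ≥ 1 let γ_n(t) = (cos(n t), cos((n+1) t)) and let P_n = { γ_n( (i/(n+1))π + (j/n)π ) : i,j ∈ ℕ, i + j ≤ n } be the set of Padua points of degree n. Then the binom(n+2,2) points γ_n((i/(n+1))π + (j/n)π), for (i,j) ∈ ℕ² with i+j ≤ n, are pairwise distinct, and P_n is a unisolvent set of degree n for [−1,1]²: every polynomial p ∈ ℂ[x,y] of total degree ≤ n that vanishes at every point of P_n is identically zero. -/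
open Filter MeasureTheory Real

noncomputable section

/-- The sampling angle `θ = (i/(n+1))π + (j/n)π` of a Padua point. -/
def paduaAngle (n i j : ℕ) : ℝ := ((i : ℝ) / ((n : ℝ) + 1)) * π + ((j : ℝ) / (n : ℝ)) * π

/-- The Padua point `γ_n((i/(n+1))π + (j/n)π)` where `γ_n(t) = (cos(nt), cos((n+1)t))`,
viewed as a point of `ℂ²`. -/
def padua (n i j : ℕ) : Fin 2 → ℂ :=
  ![((Real.cos ((n : ℝ) * paduaAngle n i j) : ℝ) : ℂ),
    ((Real.cos (((n : ℝ) + 1) * paduaAngle n i j) : ℝ) : ℂ)]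

/-- The point `(cos (aπ/(n+1)), cos (bπ/n))` of the Chebyshev-Lobatto grid, viewed in `ℂ²`. -/
def lobattoPoint (n a b : ℕ) : Fin 2 → ℂ :=
  ![((Real.cos (a * π / (n + 1)) : ℝ) : ℂ), ((Real.cos (b * π / n) : ℝ) : ℂ)]

lemma eq_of_cos_mul_pi_div_eq {m a b : ℕ} (hm : 0 < m) (ha : a ≤ m) (hb : b ≤ m)
    (h : Real.cos (a * π / m) = Real.cos (b * π / m)) : a = b := by
  have hm' : (0 : ℝ) < m := by exact_mod_cast hm
  have mem : ∀ c : ℕ, c ≤ m → (c * π / m : ℝ) ∈ Set.Icc 0 π := fun c hc ↦ by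
    have hc' : (c : ℝ) ≤ m := by exact_mod_cast hc
    refine ⟨by positivity, ?_⟩
    rw [div_le_iff₀ hm']
    nlinarith [pi_pos]
  have := injOn_cos (mem a ha) (mem b hb) h
  field_simp at this
  exact_mod_cast this

lemma lobattoPoint_injOn {n a b a' b' : ℕ} (hn : 1 ≤ n) (ha : a ≤ n + 1) (hb : b ≤ n)
    (ha' : a' ≤ n + 1) (hb' : b' ≤ n) (h : lobattoPoint n a b = lobattoPoint n a' b') :
    a = a' ∧ b = b' := by
  have h0 := Complex.ofReal_injective (congrFun h 0)
  have h1 := Complex.ofReal_injective (congrFun h 1)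
  refine ⟨eq_of_cos_mul_pi_div_eq n.succ_pos ha ha' ?_, eq_of_cos_mul_pi_div_eq hn hb hb' h1⟩
  exact_mod_cast h0

lemma padua_eq_neg_one_pow {n : ℕ} (hn : 1 ≤ n) (i j : ℕ) :
    padua n i j = (-1 : ℂ) ^ (i + j) • lobattoPoint n i j := by
  have hn' : (n : ℝ) ≠ 0 := by positivity
  have h0 : (n : ℝ) * paduaAngle n i j = (i + j : ℕ) * π - i * π / (n + 1) := by
    unfold paduaAngle; push_cast; field_simp; ring
  have h1 : ((n : ℝ) + 1) * paduaAngle n i j = j * π / n + (i + j : ℕ) * π := by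
    unfold paduaAngle; push_cast; field_simp; ring
  ext k
  fin_cases k
  · simp only [padua, lobattoPoint, h0, Real.cos_nat_mul_pi_sub]
    simp
  · simp only [padua, lobattoPoint, h1, Real.cos_add_nat_mul_pi]
    simp

lemma neg_lobattoPoint {n a b : ℕ} (hn : 1 ≤ n) (ha : a ≤ n + 1) (hb : b ≤ n) :
    -lobattoPoint n a b = lobattoPoint n (n + 1 - a) (n - b) := by
  have hn' : (n : ℝ) ≠ 0 := by positivity
  have h0 : ((n + 1 - a : ℕ) : ℝ) * π / (n + 1) = π - a * π / (n + 1) := by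
    rw [Nat.cast_sub ha]; push_cast; field_simp
  have h1 : ((n - b : ℕ) : ℝ) * π / n = π - b * π / n := by
    rw [Nat.cast_sub hb]; field_simp
  ext k
  fin_cases k
  · simp only [lobattoPoint, h0, Real.cos_pi_sub]
    simp
  · simp only [lobattoPoint, h1, Real.cos_pi_sub]
    simp

lemma padua_of_even {n i j : ℕ} (hn : 1 ≤ n) (h : Even (i + j)) :
    padua n i j = lobattoPoint n i j := by
  rw [padua_eq_neg_one_pow hn, h.neg_one_pow, one_smul]

lemma padua_of_odd {n i j : ℕ} (hn : 1 ≤ n) (hij : i + j ≤ n) (h : Odd (i + j)) :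
    padua n i j = lobattoPoint n (n + 1 - i) (n - j) := by
  rw [padua_eq_neg_one_pow hn, h.neg_one_pow, neg_one_smul, neg_lobattoPoint hn] <;> omega

lemma padua_injOn {n i j i' j' : ℕ} (hn : 1 ≤ n) (hij : i + j ≤ n) (hij' : i' + j' ≤ n)
    (h : padua n i j = padua n i' j') : i = i' ∧ j = j' := by
  rcases Nat.even_or_odd (i + j) with he | ho <;> rcases Nat.even_or_odd (i' + j') with he' | ho'
  · rw [padua_of_even hn he, padua_of_even hn he'] at h
    exact lobattoPoint_injOn hn (by omega) (by omega) (by omega) (by omega) h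
  · rw [padua_of_even hn he, padua_of_odd hn hij' ho'] at h
    have := lobattoPoint_injOn hn (by omega) (by omega) (by omega) (by omega) h
    omega
  · rw [padua_of_odd hn hij ho, padua_of_even hn he'] at h
    have := lobattoPoint_injOn hn (by omega) (by omega) (by omega) (by omega) h
    omega
  · rw [padua_of_odd hn hij ho, padua_of_odd hn hij' ho'] at h
    have := lobattoPoint_injOn hn (by omega) (by omega) (by omega) (by omega) h
    omega

/-- Grid points with even index sum are Padua points. -/
lemma exists_padua_eq_lobattoPoint {n a b : ℕ} (hn : 1 ≤ n) (ha : a ≤ n + 1) (hb : b ≤ n)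
    (h : Even (a + b)) : ∃ i j : ℕ, i + j ≤ n ∧ padua n i j = lobattoPoint n a b := by
  by_cases hab : a + b ≤ n
  · exact ⟨a, b, hab, padua_of_even hn h⟩
  · refine ⟨n + 1 - a, n - b, by omega, ?_⟩
    rw [padua_of_odd hn (by omega) (by grind)]
    congr 1 <;> omega

lemma exists_cos_mul_pi_div_eq {m : ℕ} (hm : 0 < m) (k : ℕ) :
    ∃ a ≤ m, Even (a + k) ∧ Real.cos (k * π / m) = Real.cos (a * π / m) := by
  have hm' : (m : ℝ) ≠ 0 := by positivity
  have hk := Nat.mod_add_div k (2 * m)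
  have hr : k % (2 * m) < 2 * m := Nat.mod_lt _ (by omega)
  generalize k % (2 * m) = r at hk hr
  generalize k / (2 * m) = q at hk
  have hcos : Real.cos (k * π / m) = Real.cos (r * π / m) := by
    have : (k * π / m : ℝ) = r * π / m + q * (2 * π) := by
      rw [← hk]; push_cast; field_simp
    rw [this, Real.cos_add_nat_mul_two_pi]
  have hk2 : k = r + 2 * (m * q) := by rw [← hk]; ring
  by_cases hrm : r ≤ m
  · exact ⟨r, hrm, by grind, hcos⟩
  · refine ⟨2 * m - r, by omega, by grind, ?_⟩
    have : ((2 * m - r : ℕ) : ℝ) * π / m = 2 * π - r * π / m := by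
      rw [Nat.cast_sub hr.le]; push_cast; field_simp
    rw [hcos, this, Real.cos_two_pi_sub]

lemma exists_padua_eq_curve {n : ℕ} (hn : 1 ≤ n) (k : ℕ) :
    ∃ i j : ℕ, i + j ≤ n ∧ padua n i j = lobattoPoint n k k := by
  obtain ⟨a, ha, hak, hca⟩ := exists_cos_mul_pi_div_eq n.succ_pos k
  obtain ⟨b, hb, hbk, hcb⟩ := exists_cos_mul_pi_div_eq hn k
  obtain ⟨i, j, hij, h⟩ := exists_padua_eq_lobattoPoint hn ha hb (by grind)
  refine ⟨i, j, hij, ?_⟩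
  push_cast at hca
  rw [h, lobattoPoint, lobattoPoint, hca, hcb]

/-- The pullback of a bivariate polynomial along `x ↦ (T_n x, T_{n+1} x)`, where `T_n` is the
Chebyshev polynomial of the first kind. -/
def chebyshevPullback (n : ℕ) (p : MvPolynomial (Fin 2) ℂ) : Polynomial ℂ :=
  MvPolynomial.aeval
    ![Polynomial.Chebyshev.T ℂ (n : ℤ), Polynomial.Chebyshev.T ℂ ((n + 1 : ℕ) : ℤ)] p

/-- The pullback of a single monomial. -/
def chebyshevTerm (n : ℕ) (p : MvPolynomial (Fin 2) ℂ) (d : Fin 2 →₀ ℕ) : Polynomial ℂ :=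
  Polynomial.C (p.coeff d) * (Polynomial.Chebyshev.T ℂ (n : ℤ) ^ d 0 *
    Polynomial.Chebyshev.T ℂ ((n + 1 : ℕ) : ℤ) ^ d 1)

lemma chebyshevPullback_eq_sum (n : ℕ) (p : MvPolynomial (Fin 2) ℂ) :
    chebyshevPullback n p = ∑ d ∈ p.support, chebyshevTerm n p d := by
  rw [chebyshevPullback, MvPolynomial.aeval_def, MvPolynomial.eval₂_eq']
  simp [chebyshevTerm, Fin.prod_univ_two]

lemma degree_chebyshevTerm {n : ℕ} {p : MvPolynomial (Fin 2) ℂ} {d : Fin 2 →₀ ℕ}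
    (hd : d ∈ p.support) :
    (chebyshevTerm n p d).degree = ((n * d 0 + (n + 1) * d 1 : ℕ) : WithBot ℕ) := by
  rw [chebyshevTerm, Polynomial.degree_C_mul (MvPolynomial.mem_support_iff.mp hd),
    Polynomial.degree_mul, Polynomial.degree_pow, Polynomial.degree_pow,
    Polynomial.Chebyshev.degree_T, Polynomial.Chebyshev.degree_T, Int.natAbs_natCast,
    Int.natAbs_natCast, nsmul_eq_mul, nsmul_eq_mul]
  norm_cast
  ring

lemma add_le_totalDegree {p : MvPolynomial (Fin 2) ℂ} {d : Fin 2 →₀ ℕ} (hd : d ∈ p.support) :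
    d 0 + d 1 ≤ p.totalDegree := by
  have := MvPolynomial.le_totalDegree hd
  rwa [Finsupp.sum_fintype _ _ (fun _ ↦ rfl), Fin.sum_univ_two] at this

lemma degree_chebyshevPullback {n : ℕ} {p : MvPolynomial (Fin 2) ℂ} (hp : p.totalDegree ≤ n) :
    (chebyshevPullback n p).degree =
      p.support.sup fun d ↦ ((n * d 0 + (n + 1) * d 1 : ℕ) : WithBot ℕ) := by
  rw [chebyshevPullback_eq_sum, Polynomial.degree_sum_eq_of_disjoint]
  · exact Finset.sup_congr rfl fun d hd ↦ degree_chebyshevTerm hd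
  · rintro d ⟨hd, -⟩ e ⟨he, -⟩ hne heq
    apply hne
    simp only [Function.comp_apply, degree_chebyshevTerm hd, degree_chebyshevTerm he,
      Nat.cast_inj] at heq
    have hdn := (add_le_totalDegree hd).trans hp
    have hen := (add_le_totalDegree he).trans hp
    have key : ∀ a b a' b' : ℕ, a + b ≤ n → a' + b' ≤ n →
        n * a + (n + 1) * b = n * a' + (n + 1) * b' → a + b ≤ a' + b' := by
      intro a b a' b' h h' hh
      by_contra! hlt
      have : n * (a' + b' + 1) ≤ n * (a + b) := Nat.mul_le_mul_left n hlt
      nlinarith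
    have hsum : d 0 + d 1 = e 0 + e 1 :=
      le_antisymm (key _ _ _ _ hdn hen heq) (key _ _ _ _ hen hdn heq.symm)
    have h1 : d 1 = e 1 := by
      have : n * (d 0 + d 1) = n * (e 0 + e 1) := by rw [hsum]
      linarith
    ext k
    fin_cases k
    · change d 0 = e 0
      omega
    · exact h1

lemma chebyshevPullback_eval_cos (n : ℕ) (p : MvPolynomial (Fin 2) ℂ) (θ : ℝ) :
    (chebyshevPullback n p).eval ((Real.cos θ : ℝ) : ℂ) =
      MvPolynomial.eval
        ![((Real.cos (n * θ) : ℝ) : ℂ), ((Real.cos ((n + 1) * θ) : ℝ) : ℂ)] p := by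
  rw [chebyshevPullback, ← Polynomial.coe_evalRingHom, MvPolynomial.aeval_def,
    MvPolynomial.eval₂_comp_left, MvPolynomial.eval, MvPolynomial.coe_eval₂Hom]
  congr 1
  · ext
    simp
  · ext k
    fin_cases k
    · simp
    · simp

lemma eq_zero_of_eval_padua_eq_zero {n : ℕ} (hn : 1 ≤ n) {p : MvPolynomial (Fin 2) ℂ}
    (hp : p.totalDegree ≤ n)
    (h : ∀ i j : ℕ, i + j ≤ n → MvPolynomial.eval (padua n i j) p = 0) : p = 0 := by
  have hn' : (n : ℝ) ≠ 0 := by positivity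
  have hdeg := degree_chebyshevPullback hp
  have hle : (chebyshevPullback n p).natDegree < n * (n + 1) + 1 := by
    rw [Nat.lt_succ_iff]
    apply Polynomial.natDegree_le_of_degree_le
    rw [hdeg, Finset.sup_le_iff]
    intro d hd
    have := (add_le_totalDegree hd).trans hp
    norm_cast
    nlinarith
  have hzero : chebyshevPullback n p = 0 := by
    refine Polynomial.eq_zero_of_natDegree_lt_card_of_eval_eq_zero (chebyshevPullback n p)
      (f := fun k : Fin (n * (n + 1) + 1) ↦
        ((Real.cos ((k : ℕ) * π / (n * (n + 1) : ℕ)) : ℝ) : ℂ)) ?_ ?_ (by simpa using hle)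
    · intro k l hkl
      exact Fin.ext (eq_of_cos_mul_pi_div_eq (by positivity) (by omega) (by omega)
        (Complex.ofReal_injective hkl))
    · intro k
      obtain ⟨i, j, hij, hpt⟩ := exists_padua_eq_curve hn (k : ℕ)
      rw [chebyshevPullback_eval_cos, ← h i j hij, hpt, lobattoPoint]
      congr 5 <;> push_cast <;> field_simp
  rw [hzero, Polynomial.degree_zero] at hdeg
  by_contra hp0
  obtain ⟨d, hd⟩ := MvPolynomial.support_nonempty.mpr hp0
  have := (Finset.sup_eq_bot_iff _ _).mp hdeg.symm d hd
  exact WithBot.coe_ne_bot this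

lemma ncard_padua {n : ℕ} (hn : 1 ≤ n) :
    {w : Fin 2 → ℂ | ∃ i j : ℕ, i + j ≤ n ∧ w = padua n i j}.ncard = Nat.choose (n + 2) 2 := by
  have himage : {w : Fin 2 → ℂ | ∃ i j : ℕ, i + j ≤ n ∧ w = padua n i j} =
      (fun x : ℕ × ℕ ↦ padua n x.1 x.2) ''
        ((Finset.range (n + 1)).biUnion Finset.HasAntidiagonal.antidiagonal : Finset (ℕ × ℕ)) := by
    ext w
    simp [eq_comm]
  rw [himage, Set.InjOn.ncard_image, Set.ncard_coe_finset, Finset.card_biUnion]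
  · simp only [Finset.Nat.card_antidiagonal]
    rw [Nat.choose_two_right, ← Finset.sum_range_id, Finset.sum_range_succ' _ (n + 1), add_zero]
  · intro s _ t _ hst
    rw [Function.onFun, Finset.disjoint_left]
    intro x hx hx'
    rw [Finset.HasAntidiagonal.mem_antidiagonal] at hx hx'
    exact hst (hx.symm.trans hx')
  · rintro ⟨i, j⟩ hx ⟨i', j'⟩ hx' hxy
    simp only [Finset.coe_biUnion, Set.mem_iUnion, Finset.mem_coe, Finset.mem_range,
      Finset.HasAntidiagonal.mem_antidiagonal, exists_prop, exists_eq_right',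
      Nat.lt_succ_iff] at hx hx'
    exact Prod.ext_iff.mpr (padua_injOn hn hx hx' hxy)

theorem statement8 (n : ℕ) (hn : 1 ≤ n) :
    (∀ i j i' j' : ℕ, i + j ≤ n → i' + j' ≤ n →
      padua n i j = padua n i' j' → i = i' ∧ j = j') ∧
    {w : Fin 2 → ℂ | ∃ i j : ℕ, i + j ≤ n ∧ w = padua n i j}.ncard
      = Nat.choose (n + 2) 2 ∧
    (∀ p : MvPolynomial (Fin 2) ℂ, p.totalDegree ≤ n →
      (∀ i j : ℕ, i + j ≤ n → MvPolynomial.eval (padua n i j) p = 0) → p = 0) :=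
  ⟨fun _ _ _ _ hij hij' h ↦ padua_injOn hn hij hij' h, ncard_padua hn,
    fun _ hp h ↦ eq_zero_of_eval_padua_eq_zero hn hp h⟩
end
end

section
/- Let d ≥ 1, n ∈ ℕ, and for s = 1,…,d let A_s = (a_{0s},…,a_{ns}) be an (n+1)-tuple of pairwise distinct complex numbers. Then the intertwined set A_1 ⊕ A_2 ⊕ ⋯ ⊕ A_d := { (a_{i_1 1}, a_{i_2 2}, …, a_{i_d d}) : i_1 + i_2 + ⋯ + i_d ≤ n } ⊂ ℂ^d consists of exactly binom(n+d,d) pairwise distinct points and is unisolvent of degree n in ℂ^d: every polynomial p ∈ ℂ[z_1,…,z_d] of total degree ≤ n that vanishes at every point of A_1 ⊕ ⋯ ⊕ A_d is identically zero. -/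
open Filter MeasureTheory Real

noncomputable section

theorem natCard_sum_le_eq_choose (d n : ℕ) :
    Nat.card {i : Fin d → ℕ // ∑ s, i s ≤ n} = (n + d).choose d := by
  let e : {i : Fin d → ℕ // ∑ s, i s ≤ n} ≃ {P : Fin (d + 1) → ℕ // ∑ s, P s = n} :=
    { toFun := fun i => ⟨Fin.cons (n - ∑ s, i.1 s) i.1, by
        have := i.2
        simp [Fin.sum_univ_succ, this]⟩
      invFun := fun P => ⟨Fin.tail P.1, by
        have := P.2
        rw [Fin.sum_univ_succ] at this
        simp only [Fin.tail]
        omega⟩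
      left_inv := fun i => by simp
      right_inv := fun P => by
        have h := P.2
        rw [Fin.sum_univ_succ] at h
        refine Subtype.ext ?_
        have : n - ∑ s, Fin.tail P.1 s = P.1 0 := by
          simp only [Fin.tail]
          omega
        simp [this] }
  rw [Nat.card_congr (e.trans (Sym.equivNatSumOfFintype (Fin (d + 1)) n).symm),
    Nat.card_eq_fintype_card, Sym.card_sym_eq_choose, Fintype.card_fin]
  rw [show d + 1 + n - 1 = n + d by omega, Nat.choose_symm_add]

/-- A nonzero polynomial of total degree at most `n` does not vanish on all points
`(a_{i_s, s})_s` with `∑ s, i s ≤ n`, provided each `a s` is injective on `{0, …, n}`. -/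
theorem MvPolynomial.eq_zero_of_eval_intertwined_eq_zero {σ R : Type*} [Fintype σ]
    [CommRing R] [IsDomain R] {n : ℕ} {a : σ → ℕ → R} (ha : ∀ s, Set.InjOn (a s) (Set.Iic n))
    {p : MvPolynomial σ R} (hp : p.totalDegree ≤ n)
    (h : ∀ i : σ → ℕ, ∑ s, i s ≤ n → MvPolynomial.eval (fun s => a s (i s)) p = 0) :
    p = 0 := by
  classical
  by_contra h0
  obtain ⟨t, ht, hdeg⟩ := p.support.exists_mem_eq_sup (MvPolynomial.support_nonempty.2 h0)
    (fun t => t.sum fun _ e => e)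
  have hdeg' : p.totalDegree = t.degree := hdeg
  have hsum : ∑ s, t s ≤ n := by
    rwa [← Finsupp.degree_eq_sum, ← hdeg']
  have ht_le : ∀ s, t s ≤ n := fun s =>
    (Finset.single_le_sum (fun _ _ => Nat.zero_le _) (Finset.mem_univ s)).trans hsum
  obtain ⟨x, hx, hne⟩ := MvPolynomial.combinatorial_nullstellensatz_exists_eval_nonzero p t
    (MvPolynomial.mem_support_iff.1 ht) hdeg'
    (fun s => (Finset.range (t s + 1)).image (a s)) (fun s => by
      rw [Finset.card_image_of_injOn, Finset.card_range]
      · exact Nat.lt_succ_self _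
      · refine (ha s).mono fun k hk => ?_
        have := Finset.mem_range.1 (Finset.mem_coe.1 hk)
        have := ht_le s
        simp only [Set.mem_Iic]
        omega)
  choose i hi hix using fun s => Finset.mem_image.1 (hx s)
  obtain rfl : (fun s => a s (i s)) = x := _root_.funext hix
  exact hne (h i ((Finset.sum_le_sum fun s _ =>
    Nat.lt_succ_iff.1 (Finset.mem_range.1 (hi s))).trans hsum))

theorem statement11 {d : ℕ} (hd : 1 ≤ d) (n : ℕ) (a : Fin d → ℕ → ℂ)
    (ha : ∀ s : Fin d, ∀ i j : ℕ, i ≤ n → j ≤ n → a s i = a s j → i = j) :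
    (∀ i i' : Fin d → ℕ, (∑ s, i s) ≤ n → (∑ s, i' s) ≤ n →
      (fun s => a s (i s)) = (fun s => a s (i' s)) → i = i') ∧
    {z : Fin d → ℂ | ∃ i : Fin d → ℕ, (∑ s, i s) ≤ n ∧ z = fun s => a s (i s)}.ncard
      = Nat.choose (n + d) d ∧
    (∀ p : MvPolynomial (Fin d) ℂ, p.totalDegree ≤ n →
      (∀ i : Fin d → ℕ, (∑ s, i s) ≤ n →
        MvPolynomial.eval (fun s => a s (i s)) p = 0) → p = 0) := by
  have hinj : ∀ i i' : Fin d → ℕ, (∑ s, i s) ≤ n → (∑ s, i' s) ≤ n →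
      (fun s => a s (i s)) = (fun s => a s (i' s)) → i = i' := by
    intro i i' hi hi' h
    funext s
    exact ha s _ _
      ((Finset.single_le_sum (fun _ _ => Nat.zero_le _) (Finset.mem_univ s)).trans hi)
      ((Finset.single_le_sum (fun _ _ => Nat.zero_le _) (Finset.mem_univ s)).trans hi')
      (congrFun h s)
  refine ⟨hinj, ?_, fun p hp h => MvPolynomial.eq_zero_of_eval_intertwined_eq_zero
    (fun s i hi j hj hij => ha s i j hi hj hij) hp h⟩
  have himage : {z : Fin d → ℂ | ∃ i : Fin d → ℕ, (∑ s, i s) ≤ n ∧ z = fun s => a s (i s)} =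
      (fun (i : Fin d → ℕ) s => a s (i s)) '' {i | ∑ s, i s ≤ n} := by
    ext z
    simp [eq_comm]
  have hinjOn : Set.InjOn (fun (i : Fin d → ℕ) s => a s (i s)) {i | ∑ s, i s ≤ n} :=
    fun i hi i' hi' h => hinj i i' hi hi' h
  rw [himage, hinjOn.ncard_image, ← Nat.card_coe_set_eq]
  exact natCard_sum_le_eq_choose d n
end
end

section
/- Define, for a function G : [0,1] → [0,1], L(G) := ∫_0^1 x² log G(x) dx + 2 ∫_0^1 ( ∫_x^1 x·log( G(y) − G(x) ) dy ) dx. For G(x) = (1 − cos(πx))/2 = sin²(πx/2), one has L(G) = −(4/3)·log 2 + (2/π²)·Σ_{k=1}^∞ 1/k³, i.e. L(G) = −(4/3) log 2 + (2/π²) ζ(3) ≈ −0.6806085842. -/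
open Filter MeasureTheory Real intervalIntegral

noncomputable section

/-- The functional `L(G) = ∫_0^1 x² log G(x) dx + 2 ∫_0^1 ∫_x^1 x log(G(y) − G(x)) dy dx`. -/
def LG (G : ℝ → ℝ) : ℝ :=
  (∫ x in (0:ℝ)..1, x ^ 2 * Real.log (G x)) +
    2 * ∫ x in (0:ℝ)..1, (∫ y in x..(1:ℝ), x * Real.log (G y - G x))

/-- The function `x ↦ log (sin (π x / 2))`. -/
def logSinHalf (x : ℝ) : ℝ := Real.log (Real.sin (π * x / 2))

lemma intervalIntegrable_logSinHalf (a b : ℝ) : IntervalIntegrable logSinHalf volume a b := by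
  have h : AnalyticOnNhd ℝ (fun x : ℝ => Real.sin (π * x / 2)) Set.univ := by
    intro x _
    fun_prop
  exact (h.mono (Set.subset_univ _)).meromorphicOn.intervalIntegrable_log

lemma logSinHalf_two_sub (x : ℝ) : logSinHalf (2 - x) = logSinHalf x := by
  unfold logSinHalf
  rw [show π * (2 - x) / 2 = π - π * x / 2 by ring, Real.sin_pi_sub]

lemma sin_pi_mul_div_two_pos {x : ℝ} (h0 : 0 < x) (h2 : x < 2) : 0 < Real.sin (π * x / 2) := by
  have := Real.pi_pos
  apply Real.sin_pos_of_pos_of_lt_pi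
  · positivity
  · nlinarith

lemma continuousAt_logSinHalf {x : ℝ} (h0 : 0 < x) (h2 : x < 2) :
    ContinuousAt logSinHalf x := by
  unfold logSinHalf
  exact ContinuousAt.log (by fun_prop) (sin_pi_mul_div_two_pos h0 h2).ne'

lemma integral_logSinHalf : ∫ x in (0:ℝ)..1, logSinHalf x = -Real.log 2 := by
  have h : logSinHalf = fun x => (fun y => Real.log (Real.sin y)) ((π / 2) * x) := by
    funext x
    simp only [logSinHalf]
    ring_nf
  rw [h, intervalIntegral.integral_comp_mul_left _ (by positivity), mul_zero, mul_one,
    integral_log_sin_zero_pi_div_two, smul_eq_mul]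
  field_simp

lemma logSinHalf_two_mul {x : ℝ} (h0 : 0 < x) (h1 : x < 1) :
    logSinHalf (2 * x) = Real.log 2 + logSinHalf x + logSinHalf (1 - x) := by
  have hs := sin_pi_mul_div_two_pos h0 (by linarith)
  have hc := sin_pi_mul_div_two_pos (x := 1 - x) (by linarith) (by linarith)
  unfold logSinHalf
  rw [← Real.log_mul (by norm_num) hs.ne', ← Real.log_mul (by positivity) hc.ne',
    show π * (1 - x) / 2 = π / 2 - π * x / 2 by ring, Real.sin_pi_div_two_sub,
    ← Real.sin_two_mul]
  ring_nf

/-! ### Cosine coefficients of `logSinHalf` -/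

lemma sin_two_mul_nat_mul (k : ℕ) (θ : ℝ) :
    Real.sin (2 * k * θ) =
      Real.sin θ * ∑ j ∈ Finset.range k, 2 * Real.cos ((2 * j + 1) * θ) := by
  induction k with
  | zero => simp
  | succ k ih =>
    rw [Finset.sum_range_succ, mul_add, ← ih]
    have h1 : Real.sin (2 * ((k + 1 : ℕ) : ℝ) * θ) = Real.sin ((2 * k + 1) * θ + θ) := by
      push_cast; ring_nf
    have h2 : Real.sin (2 * k * θ) = Real.sin ((2 * k + 1) * θ - θ) := by ring_nf
    rw [h1, h2, Real.sin_add, Real.sin_sub]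
    ring

lemma integral_cos_nat_mul_pi {j : ℕ} (hj : j ≠ 0) :
    ∫ x in (0:ℝ)..1, Real.cos (j * π * x) = 0 := by
  have hc : (j * π : ℝ) ≠ 0 := by positivity
  rw [intervalIntegral.integral_comp_mul_left (fun y => Real.cos y) hc, integral_cos]
  simp [Real.sin_nat_mul_pi]

lemma integral_sum_cos_mul_cos {k : ℕ} (hk : k ≠ 0) :
    ∫ x in (0:ℝ)..1, (∑ j ∈ Finset.range k, 2 * Real.cos ((2 * j + 1) * (π * x / 2))) *
      Real.cos (π * x / 2) = 1 := by
  have h : ∀ x : ℝ, (∑ j ∈ Finset.range k, 2 * Real.cos ((2 * j + 1) * (π * x / 2))) *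
      Real.cos (π * x / 2) =
      ∑ j ∈ Finset.range k,
        (Real.cos ((j + 1 : ℕ) * π * x) + Real.cos (j * π * x)) := by
    intro x
    rw [Finset.sum_mul]
    refine Finset.sum_congr rfl fun j _ => ?_
    have h1 : ((j + 1 : ℕ) : ℝ) * π * x = (2 * j + 1) * (π * x / 2) + π * x / 2 := by
      push_cast; ring
    have h2 : (j : ℝ) * π * x = (2 * j + 1) * (π * x / 2) - π * x / 2 := by ring
    rw [h1, h2, Real.cos_add, Real.cos_sub]
    ring
  simp_rw [h]
  have hi : ∀ j : ℕ, IntervalIntegrable (fun x : ℝ => Real.cos (j * π * x)) volume 0 1 :=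
    fun j => Continuous.intervalIntegrable (by fun_prop) _ _
  rw [intervalIntegral.integral_finsetSum fun j _ => (hi _).add (hi _)]
  obtain ⟨m, rfl⟩ := Nat.exists_eq_succ_of_ne_zero hk
  simp_rw [intervalIntegral.integral_add (hi _) (hi _)]
  rw [Finset.sum_range_succ', integral_cos_nat_mul_pi (by simp), Finset.sum_eq_zero]
  · simp
  · intro j _
    rw [integral_cos_nat_mul_pi (by simp), integral_cos_nat_mul_pi (by simp), add_zero]

lemma integral_cos_mul_logSinHalf {k : ℕ} (hk : k ≠ 0) :
    ∫ x in (0:ℝ)..1, Real.cos (k * π * x) * logSinHalf x = -1 / (2 * k) := by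
  have hk0 : (k : ℝ) ≠ 0 := by exact_mod_cast hk
  set Q : ℝ → ℝ := fun x => ∑ j ∈ Finset.range k, 2 * Real.cos ((2 * j + 1) * (π * x / 2))
    with hQ
  have hsin : ∀ x : ℝ, Real.sin (k * π * x) = Real.sin (π * x / 2) * Q x := by
    intro x
    rw [hQ, ← sin_two_mul_nat_mul]
    ring_nf
  have hQc : Continuous Q := by fun_prop
  have hi1 : IntervalIntegrable (fun x => Real.cos (k * π * x) * logSinHalf x) volume 0 1 :=
    (intervalIntegrable_logSinHalf 0 1).continuousOn_mul (by fun_prop)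
  have hi2 : IntervalIntegrable (fun x => (1 / (2 * k)) * (Q x * Real.cos (π * x / 2)))
      volume 0 1 := Continuous.intervalIntegrable (by fun_prop) _ _
  have key := intervalIntegral.integral_eq_sub_of_hasDerivAt_of_le (a := 0) (b := 1)
    (f := fun x => (1 / (k * π)) * (Q x * (Real.sin (π * x / 2) * Real.log (Real.sin (π * x / 2)))))
    (f' := fun x => Real.cos (k * π * x) * logSinHalf x
      + (1 / (2 * k)) * (Q x * Real.cos (π * x / 2))) zero_le_one
    (by
      have := Real.continuous_mul_log.comp
        (by fun_prop : Continuous fun x : ℝ => Real.sin (π * x / 2))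
      exact (continuous_const.mul (hQc.mul this)).continuousOn)
    (by
      intro x hx
      have hs := sin_pi_mul_div_two_pos hx.1 (by linarith [hx.2])
      have hlin : HasDerivAt (fun x : ℝ => π * x / 2) (π / 2) x := by
        simpa using ((hasDerivAt_id x).const_mul π).div_const 2
      have hlin' : HasDerivAt (fun x : ℝ => k * π * x) (k * π) x := by
        simpa using (hasDerivAt_id x).const_mul (k * π)
      have hd := ((hlin'.sin.mul (hlin.sin.log hs.ne')).const_mul (1 / (k * π)))
      refine (hd.congr_deriv ?_).congr_of_eventuallyEq ?_
      · rw [hsin]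
        simp only [logSinHalf]
        field_simp
      · refine Filter.Eventually.of_forall fun y => ?_
        simp only [Pi.mul_apply, hsin]
        ring)
    (hi1.add hi2)
  rw [intervalIntegral.integral_add hi1 hi2, intervalIntegral.integral_const_mul,
    integral_sum_cos_mul_cos hk] at key
  simp only [mul_one, mul_zero, zero_div, Real.sin_zero, Real.sin_pi_div_two, Real.log_one,
    Real.log_zero, sub_zero] at key
  rw [neg_div]
  linarith

/-! ### The quadratic moment -/

lemma hasSum_cos_sub_cos {x : ℝ} (hx : x ∈ Set.Icc (0:ℝ) 1) :
    HasSum (fun n : ℕ => 8 / (π ^ 2 * (n : ℝ) ^ 2) *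
      (Real.cos ((2 * n : ℕ) * π * x) - Real.cos (n * π * x))) (6 * x ^ 2 - 4 * x) := by
  have hB : ∀ y : ℝ, (Polynomial.map (algebraMap ℚ ℝ) (Polynomial.bernoulli (2 * 1))).eval y =
      y ^ 2 - y + 1 / 6 := by
    intro y
    simp [Polynomial.bernoulli_def, Finset.sum_range_succ, bernoulli_two]
    ring
  have h1 := hasSum_one_div_nat_pow_mul_cos one_ne_zero hx
  have h2 := hasSum_one_div_nat_pow_mul_cos one_ne_zero (x := x / 2)
    ⟨by linarith [hx.1], by linarith [hx.2]⟩
  rw [hB, mul_one] at h1 h2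
  convert! (h1.sub h2).mul_left (8 / π ^ 2) using 1
  · funext n
    rw [← mul_sub, show 2 * π * n * (x / 2) = n * π * x by ring,
      show 2 * π * n * x = (2 * n : ℕ) * π * x by push_cast; ring]
    field_simp
  · norm_num
    field_simp
    ring

lemma integral_quadratic_mul_logSinHalf :
    ∫ x in (0:ℝ)..1, (6 * x ^ 2 - 4 * x) * logSinHalf x =
      (2 / π ^ 2) * ∑' k : ℕ, 1 / ((k : ℝ) + 1) ^ 3 := by
  have hsum : Summable fun n : ℕ => 16 / (π ^ 2 * (n : ℝ) ^ 2) := by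
    have := (Real.summable_one_div_nat_pow.mpr one_lt_two).mul_left (16 / π ^ 2)
    refine this.congr fun n => ?_
    rw [div_mul_div_comm, mul_one]
  have hcont : ∀ n : ℕ, Continuous fun x : ℝ => 8 / (π ^ 2 * (n : ℝ) ^ 2) *
      (Real.cos ((2 * n : ℕ) * π * x) - Real.cos (n * π * x)) := fun n => by fun_prop
  have key := intervalIntegral.hasSum_integral_of_dominated_convergence
    (μ := volume) (a := 0) (b := 1)
    (F := fun (n : ℕ) x => 8 / (π ^ 2 * (n : ℝ) ^ 2) *
      (Real.cos ((2 * n : ℕ) * π * x) - Real.cos (n * π * x)) * logSinHalf x)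
    (f := fun x => (6 * x ^ 2 - 4 * x) * logSinHalf x)
    (fun n x => 16 / (π ^ 2 * (n : ℝ) ^ 2) * |logSinHalf x|)
    (fun n => by
      have := ((intervalIntegrable_logSinHalf 0 1).continuousOn_mul
        (hcont n).continuousOn).def'
      exact this.aestronglyMeasurable)
    (fun n => by
      refine Filter.Eventually.of_forall fun x _ => ?_
      rw [norm_mul, norm_mul, Real.norm_eq_abs, Real.norm_eq_abs, Real.norm_eq_abs,
        abs_of_nonneg (by positivity)]
      refine mul_le_mul_of_nonneg_right ?_ (abs_nonneg _)
      have h2 : |Real.cos ((2 * n : ℕ) * π * x) - Real.cos (n * π * x)| ≤ 2 := by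
        rw [abs_le]
        constructor <;>
        linarith [Real.neg_one_le_cos ((2 * n : ℕ) * π * x), Real.neg_one_le_cos (n * π * x),
          Real.cos_le_one ((2 * n : ℕ) * π * x), Real.cos_le_one (n * π * x)]
      calc _ ≤ 8 / (π ^ 2 * (n : ℝ) ^ 2) * 2 := mul_le_mul_of_nonneg_left h2 (by positivity)
        _ = _ := by ring)
    (Filter.Eventually.of_forall fun x _ => hsum.mul_right _)
    (by
      simp_rw [tsum_mul_right]
      exact (intervalIntegrable_logSinHalf 0 1).abs.const_mul _)
    (by
      refine Filter.Eventually.of_forall fun x hx => ?_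
      rw [Set.uIoc_of_le zero_le_one] at hx
      exact (hasSum_cos_sub_cos ⟨hx.1.le, hx.2⟩).mul_right _)
  have hterm : ∀ n : ℕ, ∫ x in (0:ℝ)..1, 8 / (π ^ 2 * (n : ℝ) ^ 2) *
      (Real.cos ((2 * n : ℕ) * π * x) - Real.cos (n * π * x)) * logSinHalf x =
      (2 / π ^ 2) * (1 / (n : ℝ) ^ 3) := by
    intro n
    rcases eq_or_ne n 0 with rfl | hn
    · simp
    have hi : ∀ m : ℕ, IntervalIntegrable (fun x => Real.cos (m * π * x) * logSinHalf x)
        volume 0 1 := fun m =>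
      (intervalIntegrable_logSinHalf 0 1).continuousOn_mul (by fun_prop)
    simp_rw [mul_assoc (8 / (π ^ 2 * (n : ℝ) ^ 2)), sub_mul]
    rw [intervalIntegral.integral_const_mul, intervalIntegral.integral_sub (hi _) (hi _),
      integral_cos_mul_logSinHalf (by simpa using hn), integral_cos_mul_logSinHalf hn]
    push_cast
    field_simp
    norm_num
  simp_rw [hterm] at key
  rw [← key.tsum_eq, key.summable.tsum_eq_zero_add, tsum_mul_left]
  simp

/-! ### The double integral -/

lemma half_cos_sub_half_cos (x y : ℝ) :
    (1 - Real.cos (π * y)) / 2 - (1 - Real.cos (π * x)) / 2 =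
      Real.sin (π * (y + x) / 2) * Real.sin (π * (y - x) / 2) := by
  have h1 : π * y = π * (y + x) / 2 + π * (y - x) / 2 := by ring
  have h2 : π * x = π * (y + x) / 2 - π * (y - x) / 2 := by ring
  rw [congrArg Real.cos h1, congrArg Real.cos h2, Real.cos_add, Real.cos_sub]
  ring

lemma integral_log_half_cos_sub_half_cos {x : ℝ} (h0 : 0 < x) (h1 : x < 1) :
    ∫ y in x..(1:ℝ),
      Real.log ((1 - Real.cos (π * y)) / 2 - (1 - Real.cos (π * x)) / 2) =
      ∫ t in (2 * x)..2, logSinHalf t := by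
  have hi := intervalIntegrable_logSinHalf
  have hcongr : ∫ y in x..(1:ℝ),
      Real.log ((1 - Real.cos (π * y)) / 2 - (1 - Real.cos (π * x)) / 2) =
      ∫ y in x..(1:ℝ), (logSinHalf (y + x) + logSinHalf (y - x)) := by
    refine intervalIntegral.integral_congr_ae (Filter.Eventually.of_forall fun y hy => ?_)
    rw [Set.uIoc_of_le h1.le] at hy
    rw [half_cos_sub_half_cos, Real.log_mul
      (sin_pi_mul_div_two_pos (by linarith [hy.1]) (by linarith [hy.2])).ne'
      (sin_pi_mul_div_two_pos (by linarith [hy.1]) (by linarith [hy.2])).ne']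
    rfl
  have hrefl : ∫ t in (0:ℝ)..(1 - x), logSinHalf t = ∫ t in (1 + x)..2, logSinHalf t := by
    have := intervalIntegral.integral_comp_sub_left (a := 1 + x) (b := 2) logSinHalf 2
    simp_rw [logSinHalf_two_sub] at this
    rw [this]
    congr 1 <;> ring
  have hadd : IntervalIntegrable (fun y => logSinHalf (y + x)) volume x 1 := by
    simpa using (hi (x + x) (1 + x)).comp_add_right x
  have hsub : IntervalIntegrable (fun y => logSinHalf (y - x)) volume x 1 := by
    simpa using (hi (x - x) (1 - x)).comp_sub_right x
  rw [hcongr, intervalIntegral.integral_add hadd hsub,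
    intervalIntegral.integral_comp_add_right, intervalIntegral.integral_comp_sub_right,
    sub_self, hrefl, intervalIntegral.integral_add_adjacent_intervals (hi _ _) (hi _ _),
    two_mul]

lemma intervalIntegrable_logSinHalf_two_mul (a b : ℝ) :
    IntervalIntegrable (fun x => logSinHalf (2 * x)) volume a b := by
  simpa using (intervalIntegrable_logSinHalf (2 * a) (2 * b)).comp_mul_left (c := 2)

lemma integral_mul_integral_logSinHalf :
    ∫ x in (0:ℝ)..1, x * ∫ t in (2 * x)..2, logSinHalf t =
      ∫ x in (0:ℝ)..1, x ^ 2 * logSinHalf (2 * x) := by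
  have hi := intervalIntegrable_logSinHalf
  have hVc : Continuous fun x : ℝ => ∫ t in (2 * x)..2, logSinHalf t := by
    simp_rw [fun x : ℝ => intervalIntegral.integral_symm (f := logSinHalf) (μ := volume) 2 (2 * x)]
    exact ((intervalIntegral.continuous_primitive hi 2).comp (continuous_const_mul 2)).neg
  have hi1 : IntervalIntegrable (fun x : ℝ => x * ∫ t in (2 * x)..2, logSinHalf t) volume 0 1 :=
    (continuous_id.mul hVc).intervalIntegrable _ _
  have hi2 : IntervalIntegrable (fun x => x ^ 2 * logSinHalf (2 * x)) volume 0 1 :=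
    (intervalIntegrable_logSinHalf_two_mul 0 1).continuousOn_mul (by fun_prop)
  have key := intervalIntegral.integral_eq_sub_of_hasDerivAt_of_le (a := 0) (b := 1)
    (f := fun x : ℝ => x ^ 2 / 2 * ∫ t in (2 * x)..2, logSinHalf t)
    (f' := fun x => (x * ∫ t in (2 * x)..2, logSinHalf t) - x ^ 2 * logSinHalf (2 * x))
    zero_le_one
    (by fun_prop)
    (by
      intro x hx
      have hmeas : StronglyMeasurable logSinHalf := by
        unfold logSinHalf
        exact Measurable.stronglyMeasurable (by fun_prop)
      have hV := intervalIntegral.integral_hasDerivAt_left (hi (2 * x) 2)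
        hmeas.stronglyMeasurableAtFilter
        (continuousAt_logSinHalf (by linarith [hx.1]) (by linarith [hx.2]))
      have hlin : HasDerivAt (fun x : ℝ => 2 * x) 2 x := by
        simpa using (hasDerivAt_id x).const_mul (2:ℝ)
      have hd := ((hasDerivAt_pow 2 x).div_const 2).mul (hV.comp x hlin)
      refine hd.congr_deriv ?_
      simp only [Function.comp_apply]
      push_cast
      ring)
    (hi1.sub hi2)
  rw [intervalIntegral.integral_sub hi1 hi2] at key
  simp only [mul_one, intervalIntegral.integral_same, mul_zero, sub_zero, zero_pow two_ne_zero,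
    zero_div, zero_mul] at key
  linarith

lemma integral_sq_mul_logSinHalf_two_mul :
    ∫ x in (0:ℝ)..1, x ^ 2 * logSinHalf (2 * x) =
      Real.log 2 / 3 + ∫ x in (0:ℝ)..1, (x ^ 2 + (1 - x) ^ 2) * logSinHalf x := by
  have hi := intervalIntegrable_logSinHalf
  have hcongr : ∫ x in (0:ℝ)..1, x ^ 2 * logSinHalf (2 * x) =
      ∫ x in (0:ℝ)..1,
        (x ^ 2 * Real.log 2 + (x ^ 2 * logSinHalf x + x ^ 2 * logSinHalf (1 - x))) := by
    refine intervalIntegral.integral_congr_Ioo_of_le zero_le_one fun x hx => ?_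
    rw [logSinHalf_two_mul hx.1 hx.2]
    ring
  have hrefl : ∫ x in (0:ℝ)..1, x ^ 2 * logSinHalf (1 - x) =
      ∫ x in (0:ℝ)..1, (1 - x) ^ 2 * logSinHalf x := by
    have := intervalIntegral.integral_comp_sub_left (a := 0) (b := 1)
      (fun x => (1 - x) ^ 2 * logSinHalf x) 1
    simpa using this
  have h1 : IntervalIntegrable (fun x : ℝ => x ^ 2 * Real.log 2) volume 0 1 :=
    Continuous.intervalIntegrable (by fun_prop) _ _
  have h2 : IntervalIntegrable (fun x : ℝ => x ^ 2 * logSinHalf x) volume 0 1 :=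
    (hi 0 1).continuousOn_mul (by fun_prop)
  have h3 : IntervalIntegrable (fun x : ℝ => (1 - x) ^ 2 * logSinHalf x) volume 0 1 :=
    (hi 0 1).continuousOn_mul (by fun_prop)
  have h4 : IntervalIntegrable (fun x : ℝ => x ^ 2 * logSinHalf (1 - x)) volume 0 1 := by
    refine IntervalIntegrable.continuousOn_mul ?_ (by fun_prop)
    simpa using (hi 1 0).comp_sub_left 1
  simp_rw [add_mul]
  rw [hcongr, intervalIntegral.integral_add h1 (h2.add h4), intervalIntegral.integral_add h2 h4,
    hrefl, intervalIntegral.integral_add h2 h3, intervalIntegral.integral_mul_const,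
    integral_pow]
  norm_num
  ring

theorem statement17 :
    LG (fun x => (1 - Real.cos (π * x)) / 2) =
      -(4 / 3) * Real.log 2 + (2 / π ^ 2) * ∑' k : ℕ, 1 / ((k : ℝ) + 1) ^ 3 := by
  have hi := intervalIntegrable_logSinHalf 0 1
  have hA : ∫ x in (0:ℝ)..1, x ^ 2 * Real.log ((1 - Real.cos (π * x)) / 2) =
      ∫ x in (0:ℝ)..1, (2 * x ^ 2) * logSinHalf x := by
    congr 1
    funext x
    have h := half_cos_sub_half_cos 0 x
    simp only [mul_zero, Real.cos_zero, sub_self, zero_div, sub_zero, add_zero] at h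
    rw [h, ← pow_two, Real.log_pow, logSinHalf]
    push_cast
    ring
  have hB : ∫ x in (0:ℝ)..1, (∫ y in x..(1:ℝ),
      x * Real.log ((1 - Real.cos (π * y)) / 2 - (1 - Real.cos (π * x)) / 2)) =
      ∫ x in (0:ℝ)..1, x * ∫ t in (2 * x)..2, logSinHalf t := by
    refine intervalIntegral.integral_congr_Ioo_of_le zero_le_one fun x hx => ?_
    rw [intervalIntegral.integral_const_mul, integral_log_half_cos_sub_half_cos hx.1 hx.2]
  have hsplit : ∫ x in (0:ℝ)..1, (6 * x ^ 2 - 4 * x) * logSinHalf x =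
      (∫ x in (0:ℝ)..1, (2 * x ^ 2) * logSinHalf x) +
      2 * (∫ x in (0:ℝ)..1, (x ^ 2 + (1 - x) ^ 2) * logSinHalf x) -
      2 * ∫ x in (0:ℝ)..1, logSinHalf x := by
    have h1 : IntervalIntegrable (fun x : ℝ => (2 * x ^ 2) * logSinHalf x) volume 0 1 :=
      hi.continuousOn_mul (by fun_prop)
    have h2 : IntervalIntegrable (fun x : ℝ => (x ^ 2 + (1 - x) ^ 2) * logSinHalf x)
        volume 0 1 := hi.continuousOn_mul (by fun_prop)
    rw [← intervalIntegral.integral_const_mul, ← intervalIntegral.integral_const_mul,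
      ← intervalIntegral.integral_add h1 (h2.const_mul 2),
      ← intervalIntegral.integral_sub (h1.add (h2.const_mul 2)) (hi.const_mul 2)]
    congr 1
    funext x
    ring
  rw [integral_quadratic_mul_logSinHalf, integral_logSinHalf] at hsplit
  unfold LG
  rw [hA, hB, integral_mul_integral_logSinHalf, integral_sq_mul_logSinHalf_two_mul]
  linarith
end
end

section
/- Define, for a function G : [0,1] → [0,1], L(G) := ∫_0^1 x² log G(x) dx + 2 ∫_0^1 ( ∫_x^1 x·log( G(y) − G(x) ) dy ) dx. For G(x) = 1 − (x² − 1)², one has L(G) = −26/9 − 4·log 2 + 4·√2·log(√2 + 1) ≈ −0.675675691. -/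
open Filter MeasureTheory Real intervalIntegral

noncomputable section

/-- An antiderivative of `t ↦ (t + c) * negMulLog t`. -/
def negMulLogPrimitive (c t : ℝ) : ℝ :=
  (t ^ 2 / 3 + c * t / 2) * negMulLog t + t ^ 3 / 9 + c * t ^ 2 / 4

theorem continuous_negMulLogPrimitive (c : ℝ) : Continuous (negMulLogPrimitive c) := by
  unfold negMulLogPrimitive
  fun_prop

theorem hasDerivAt_negMulLogPrimitive (c : ℝ) {t : ℝ} (ht : t ≠ 0) :
    HasDerivAt (negMulLogPrimitive c) ((t + c) * negMulLog t) t := by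
  have h := (((((hasDerivAt_pow 2 t).div_const 3).add
    (((hasDerivAt_id t).const_mul c).div_const 2)).mul (hasDerivAt_negMulLog ht)).add
    ((hasDerivAt_pow 3 t).div_const 9)).add (((hasDerivAt_pow 2 t).const_mul c).div_const 4)
  refine h.congr_deriv ?_
  simp only [negMulLog, Pi.add_apply, id]
  push_cast
  ring

theorem hasDerivAt_sqrt_two_sub_sq {x : ℝ} (hx : 0 < 2 - x ^ 2) :
    HasDerivAt (fun x => √(2 - x ^ 2)) (-x / √(2 - x ^ 2)) x := by
  have h := ((hasDerivAt_pow 2 x).const_sub 2).sqrt hx.ne'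
  refine h.congr_deriv ?_
  push_cast
  field_simp

theorem integral_log_sub_left (c a b : ℝ) :
    ∫ y in a..b, log (c - y) = negMulLog (c - b) - negMulLog (c - a) - b + a := by
  rw [intervalIntegral.integral_comp_sub_left (fun y => log y), integral_log]
  simp only [negMulLog]
  ring

theorem integral_log_sub_right (c a b : ℝ) :
    ∫ y in a..b, log (y - c) = negMulLog (a - c) - negMulLog (b - c) - b + a := by
  rw [intervalIntegral.integral_comp_sub_right (fun y => log y), integral_log]
  simp only [negMulLog]
  ring

theorem integral_log_add_right (c a b : ℝ) :
    ∫ y in a..b, log (y + c) = negMulLog (a + c) - negMulLog (b + c) - b + a := by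
  rw [intervalIntegral.integral_comp_add_right (fun y => log y), integral_log]
  simp only [negMulLog]
  ring

theorem intervalIntegrable_log_sub_left (c a b : ℝ) :
    IntervalIntegrable (fun y => log (c - y)) volume a b := by
  simpa using (intervalIntegrable_log' (a := c - a) (b := c - b)).comp_sub_left c

theorem intervalIntegrable_log_sub_right (c a b : ℝ) :
    IntervalIntegrable (fun y => log (y - c)) volume a b := by
  simpa using (intervalIntegrable_log' (a := a - c) (b := b - c)).comp_sub_right c

theorem intervalIntegrable_log_add_right (c a b : ℝ) :
    IntervalIntegrable (fun y => log (y + c)) volume a b := by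
  simpa using (intervalIntegrable_log' (a := a + c) (b := b + c)).comp_add_right c

theorem one_lt_sqrt_two_sub_sq {x : ℝ} (hx : x ∈ Set.Ioo (0 : ℝ) 1) : 1 < √(2 - x ^ 2) := by
  obtain ⟨h0, h1⟩ := hx
  rw [Real.lt_sqrt one_pos.le]
  nlinarith

/-- The inner integral of `LG (fun x => 1 - (x ^ 2 - 1) ^ 2)`, without its factor `x`. -/
def innerLogIntegral (x : ℝ) : ℝ :=
  negMulLog (2 * x) - negMulLog (1 - x) - negMulLog (1 + x)
    + negMulLog (√(2 - x ^ 2) - 1) - negMulLog (√(2 - x ^ 2) + 1)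
    + (negMulLog (√(2 - x ^ 2) + x) - negMulLog (√(2 - x ^ 2) - x)) - 4 * (1 - x)

theorem integral_log_difference {x : ℝ} (hx : x ∈ Set.Ioo (0 : ℝ) 1) :
    ∫ y in x..1, x * log ((1 - (y ^ 2 - 1) ^ 2) - (1 - (x ^ 2 - 1) ^ 2)) =
      x * innerLogIntegral x := by
  have ha := one_lt_sqrt_two_sub_sq hx
  obtain ⟨h0, h1⟩ := hx
  have hsq : √(2 - x ^ 2) ^ 2 = 2 - x ^ 2 := Real.sq_sqrt (by nlinarith)
  set a := √(2 - x ^ 2) with ha_def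
  rw [intervalIntegral.integral_const_mul]
  congr 1
  have hcongr : ∫ y in x..1, log ((1 - (y ^ 2 - 1) ^ 2) - (1 - (x ^ 2 - 1) ^ 2)) =
      ∫ y in x..1, (log (y - x) + log (y + x) + (log (a - y) + log (y + a))) := by
    refine integral_congr_Ioo_of_le h1.le fun y hy => ?_
    obtain ⟨hxy, hy1⟩ := hy
    have e1 : 0 < y - x := by linarith
    have e2 : 0 < y + x := by linarith
    have e3 : 0 < a - y := by linarith
    have e4 : 0 < y + a := by linarith
    rw [← log_mul e1.ne' e2.ne', ← log_mul e3.ne' e4.ne', ← log_mul (by positivity) (by positivity)]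
    congr 1
    linear_combination (-(y - x) * (y + x)) * hsq
  rw [hcongr, intervalIntegral.integral_add
      ((intervalIntegrable_log_sub_right _ _ _).add (intervalIntegrable_log_add_right _ _ _))
      ((intervalIntegrable_log_sub_left _ _ _).add (intervalIntegrable_log_add_right _ _ _)),
    intervalIntegral.integral_add (intervalIntegrable_log_sub_right _ _ _)
      (intervalIntegrable_log_add_right _ _ _),
    intervalIntegral.integral_add (intervalIntegrable_log_sub_left _ _ _)
      (intervalIntegrable_log_add_right _ _ _),
    integral_log_sub_right, integral_log_sub_left, integral_log_add_right, integral_log_add_right,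
    innerLogIntegral, ← ha_def, sub_self, negMulLog_zero, ← two_mul, add_comm x a, add_comm 1 a]
  ring

/-- An antiderivative on `(0, 1)`, continuous on `[0, 1]`, of
`x * (negMulLog (√(2 - x ^ 2) + x) - negMulLog (√(2 - x ^ 2) - x))`. -/
def mixedPrimitive (x : ℝ) : ℝ :=
  √(2 - x ^ 2) ^ 3 / 3 * (2 * log (√(2 - x ^ 2) + x) - log 2 - log (1 + x))
    - x ^ 3 / 3 * (log 2 + log (1 + x)) + 2 * x ^ 3 / 9 - 2 / 3 * log (1 + x)
    - negMulLog (1 - x) * ((1 + x + x ^ 2) / 3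
      - (1 + x) * (1 + √(2 - x ^ 2) + √(2 - x ^ 2) ^ 2) / (3 * (1 + √(2 - x ^ 2))))

theorem continuousOn_mixedPrimitive : ContinuousOn mixedPrimitive (Set.Icc 0 1) := by
  have h1 : ∀ x ∈ Set.Icc (0 : ℝ) 1, √(2 - x ^ 2) + x ≠ 0 := fun x ⟨h0, h1⟩ => by
    have : 0 < √(2 - x ^ 2) := Real.sqrt_pos.2 (by nlinarith)
    positivity
  have h2 : ∀ x ∈ Set.Icc (0 : ℝ) 1, 1 + x ≠ 0 := fun x ⟨h0, h1⟩ => by positivity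
  have h3 : ∀ x ∈ Set.Icc (0 : ℝ) 1, 3 * (1 + √(2 - x ^ 2)) ≠ 0 := fun x ⟨h0, h1⟩ => by positivity
  unfold mixedPrimitive
  fun_prop (disch := assumption)

theorem mixedPrimitive_eq {x : ℝ} (hx : x ∈ Set.Ioo (0 : ℝ) 1) :
    mixedPrimitive x =
      √(2 - x ^ 2) ^ 3 / 3 * (2 * log (√(2 - x ^ 2) + x) - log 2 - log (1 + x) - log (1 - x))
        - x ^ 3 / 3 * (log 2 + log (1 + x) + log (1 - x)) + 2 * x ^ 3 / 9
        - 2 / 3 * (log (1 + x) - log (1 - x)) := by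
  have ha := one_lt_sqrt_two_sub_sq hx
  obtain ⟨h0, h1⟩ := hx
  have hsq : √(2 - x ^ 2) ^ 2 = 2 - x ^ 2 := Real.sq_sqrt (by nlinarith)
  unfold mixedPrimitive negMulLog
  set a := √(2 - x ^ 2)
  have key : (1 - x) * ((1 + x + x ^ 2) / 3 - (1 + x) * (1 + a + a ^ 2) / (3 * (1 + a))) =
      2 / 3 - a ^ 3 / 3 - x ^ 3 / 3 := by
    have : 1 + a ≠ 0 := by positivity
    field_simp
    linear_combination (1 + a + a ^ 2) * hsq
  linear_combination log (1 - x) * key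

theorem hasDerivAt_mixedPrimitive {x : ℝ} (hx : x ∈ Set.Ioo (0 : ℝ) 1) :
    HasDerivAt mixedPrimitive
      (x * (negMulLog (√(2 - x ^ 2) + x) - negMulLog (√(2 - x ^ 2) - x))) x := by
  have hev : mixedPrimitive =ᶠ[nhds x] _ :=
    Filter.eventually_of_mem (Ioo_mem_nhds hx.1 hx.2) fun y hy => mixedPrimitive_eq hy
  refine HasDerivAt.congr_of_eventuallyEq ?_ hev
  have ha := one_lt_sqrt_two_sub_sq hx
  obtain ⟨h0, h1⟩ := hx
  have hpos : 0 < 2 - x ^ 2 := by nlinarith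
  have hsq : √(2 - x ^ 2) ^ 2 = 2 - x ^ 2 := Real.sq_sqrt hpos.le
  have hda := hasDerivAt_sqrt_two_sub_sq hpos
  have e1 : 0 < √(2 - x ^ 2) + x := by linarith
  have e2 : 0 < √(2 - x ^ 2) - x := by linarith
  have e3 : 0 < 1 + x := by linarith
  have e4 : 0 < 1 - x := by linarith
  have hl1 := (hda.add (hasDerivAt_id x)).log e1.ne'
  have hl3 := ((hasDerivAt_id x).const_add 1).log e3.ne'
  have hl4 := ((hasDerivAt_id x).const_sub 1).log e4.ne'
  have h := (((((hda.pow 3).div_const 3).mul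
      ((((hl1.const_mul 2).sub_const (log 2)).sub hl3).sub hl4)).sub
    (((hasDerivAt_pow 3 x).div_const 3).mul ((hl3.const_add (log 2)).add hl4))).add
    (((hasDerivAt_pow 3 x).const_mul 2).div_const 9)).sub ((hl3.sub hl4).const_mul (2 / 3))
  refine h.congr_deriv ?_
  have hlog : log (√(2 - x ^ 2) - x) =
      log 2 + log (1 - x) + log (1 + x) - log (√(2 - x ^ 2) + x) := by
    rw [eq_sub_iff_add_eq, ← log_mul e2.ne' e1.ne', ← log_mul two_ne_zero e4.ne',
      ← log_mul (by positivity) e3.ne']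
    congr 1
    linear_combination hsq
  simp only [negMulLog, hlog, id, Pi.add_apply, Pi.sub_apply, Pi.pow_apply]
  clear h hl1 hl3 hl4 hda hlog hev
  set a := √(2 - x ^ 2)
  generalize log (a + x) = A
  generalize log (1 + x) = B
  generalize log (1 - x) = C
  generalize log 2 = D
  have hΛ : 2 * ((-x / a + 1) / (a + x)) - 1 / (1 + x) - -1 / (1 - x) =
      2 / (a * ((1 + x) * (1 - x))) := by
    field_simp
    linear_combination 2 * x * hsq
  have hM : 1 / (1 + x) + -1 / (1 - x) = -2 * x / ((1 + x) * (1 - x)) := by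
    field_simp
    ring
  have hT : 1 / (1 + x) - -1 / (1 - x) = 2 / ((1 + x) * (1 - x)) := by
    field_simp
    ring
  rw [hΛ, hM, hT]
  push_cast
  field_simp
  linear_combination 18 * hsq

/-- An antiderivative on `(0, 1)` of `x * innerLogIntegral x`, continuous on `[0, 1]`. -/
def outerPrimitive (x : ℝ) : ℝ :=
  negMulLogPrimitive 0 (2 * x) / 4 - negMulLogPrimitive (-1) (1 - x)
    - negMulLogPrimitive (-1) (1 + x) - negMulLogPrimitive 1 (√(2 - x ^ 2) - 1)
    + negMulLogPrimitive (-1) (√(2 - x ^ 2) + 1) + mixedPrimitive x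
    - 2 * x ^ 2 + 4 * x ^ 3 / 3

theorem hasDerivAt_outerPrimitive {x : ℝ} (hx : x ∈ Set.Ioo (0 : ℝ) 1) :
    HasDerivAt outerPrimitive (x * innerLogIntegral x) x := by
  have hm := hasDerivAt_mixedPrimitive hx
  have ha := one_lt_sqrt_two_sub_sq hx
  obtain ⟨h0, h1⟩ := hx
  have hda := hasDerivAt_sqrt_two_sub_sq (x := x) (by nlinarith)
  have k1 := (hasDerivAt_negMulLogPrimitive 0 (t := 2 * x) (by positivity)).comp x
    ((hasDerivAt_id x).const_mul 2)
  have k2 := (hasDerivAt_negMulLogPrimitive (-1) (t := 1 - x) (by linarith)).comp x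
    ((hasDerivAt_id x).const_sub 1)
  have k3 := (hasDerivAt_negMulLogPrimitive (-1) (t := 1 + x) (by positivity)).comp x
    ((hasDerivAt_id x).const_add 1)
  have k4 := (hasDerivAt_negMulLogPrimitive 1 (t := √(2 - x ^ 2) - 1) (by linarith)).comp x
    (hda.sub_const 1)
  have k5 := (hasDerivAt_negMulLogPrimitive (-1) (t := √(2 - x ^ 2) + 1) (by positivity)).comp x
    (hda.add_const 1)
  have h := (((((((k1.div_const 4).sub k2).sub k3).sub k4).add k5).add hm).sub
    ((hasDerivAt_pow 2 x).const_mul 2)).add (((hasDerivAt_pow 3 x).const_mul 4).div_const 3)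
  refine h.congr_deriv ?_
  unfold innerLogIntegral
  push_cast
  field_simp
  ring

theorem continuousOn_outerPrimitive : ContinuousOn outerPrimitive (Set.Icc 0 1) := by
  have h := continuousOn_mixedPrimitive
  have hc := continuous_negMulLogPrimitive
  unfold outerPrimitive
  fun_prop

theorem integral_mul_innerLogIntegral :
    ∫ x in (0 : ℝ)..1, x * innerLogIntegral x = outerPrimitive 1 - outerPrimitive 0 := by
  refine integral_eq_sub_of_hasDerivAt_of_le zero_le_one continuousOn_outerPrimitive
    (fun x hx => hasDerivAt_outerPrimitive hx) (Continuous.intervalIntegrable ?_ _ _)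
  unfold innerLogIntegral
  fun_prop

theorem log_sqrt_two_sub_one : log (√2 - 1) = -log (√2 + 1) := by
  have hs : √2 ^ 2 = 2 := Real.sq_sqrt zero_le_two
  rw [← log_inv]
  congr 1
  field_simp
  linear_combination hs

theorem integral_sq_mul_log :
    ∫ x in (0 : ℝ)..1, x ^ 2 * log (1 - (x ^ 2 - 1) ^ 2) =
      -2 / 9 - 14 / 9 + 4 / 3 * √2 * log (√2 + 1) := by
  have hs : √2 ^ 2 = 2 := Real.sq_sqrt zero_le_two
  have hs1 : 1 < √2 := Real.one_lt_sqrt_two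
  have hlog := log_sqrt_two_sub_one
  have hcongr : ∫ x in (0 : ℝ)..1, x ^ 2 * log (1 - (x ^ 2 - 1) ^ 2) =
      ∫ x in (0 : ℝ)..1, (-2 * (x * negMulLog x) + x ^ 2 * log (2 - x ^ 2)) := by
    refine integral_congr_Ioo_of_le zero_le_one fun x hx => ?_
    obtain ⟨h0, h1⟩ := hx
    have e : 0 < 2 - x ^ 2 := by nlinarith
    have : 1 - (x ^ 2 - 1) ^ 2 = x ^ 2 * (2 - x ^ 2) := by ring
    simp only [this, negMulLog]
    rw [log_mul (by positivity) e.ne', log_pow]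
    push_cast
    ring
  have hne : ∀ x ∈ Set.Icc (0 : ℝ) 1, 2 - x ^ 2 ≠ 0 := fun x ⟨h0, h1⟩ => by nlinarith
  have hne1 : ∀ x ∈ Set.Icc (0 : ℝ) 1, √2 + x ≠ 0 := fun x ⟨h0, h1⟩ => by positivity
  have hne2 : ∀ x ∈ Set.Icc (0 : ℝ) 1, √2 - x ≠ 0 := fun x ⟨h0, h1⟩ => by linarith
  have hc := continuous_negMulLogPrimitive
  rw [hcongr, integral_eq_sub_of_hasDerivAt_of_le (f := fun x =>
      -2 * negMulLogPrimitive 0 x + x ^ 3 / 3 * log (2 - x ^ 2)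
        + 2 / 3 * (-x ^ 3 / 3 - 2 * x + √2 * (log (√2 + x) - log (√2 - x)))) zero_le_one]
  · norm_num [negMulLogPrimitive, hlog]
    ring
  · fun_prop (disch := assumption)
  · intro x hx
    have e := hne x ⟨hx.1.le, hx.2.le⟩
    have e1 := hne1 x ⟨hx.1.le, hx.2.le⟩
    have e2 := hne2 x ⟨hx.1.le, hx.2.le⟩
    have h := (((hasDerivAt_negMulLogPrimitive 0 hx.1.ne').const_mul (-2)).add
      (((hasDerivAt_pow 3 x).div_const 3).mul (((hasDerivAt_pow 2 x).const_sub 2).log e))).add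
      (((((hasDerivAt_pow 3 x).neg.div_const 3).sub ((hasDerivAt_id x).const_mul 2)).add
        (((((hasDerivAt_id x).const_add √2).log e1).sub
          (((hasDerivAt_id x).const_sub √2).log e2)).const_mul √2)).const_mul (2 / 3))
    refine h.congr_deriv ?_
    have hr : √2 * (1 / (√2 + x) - -1 / (√2 - x)) = 4 / (2 - x ^ 2) := by
      field_simp
      linear_combination (-2 * x ^ 2) * hs
    simp only [id, hr]
    push_cast
    field_simp
    ring
  · refine ContinuousOn.intervalIntegrable_of_Icc zero_le_one ?_
    fun_prop (disch := assumption)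

theorem outerPrimitive_one_sub_zero :
    outerPrimitive 1 - outerPrimitive 0 =
      -5 / 9 - 2 * log 2 + 4 / 3 * √2 * log (√2 + 1) := by
  have hs : √2 ^ 2 = 2 := Real.sq_sqrt zero_le_two
  have hlog := log_sqrt_two_sub_one
  have hlog2 : log √2 = log 2 / 2 := Real.log_sqrt zero_le_two
  norm_num [outerPrimitive, mixedPrimitive, negMulLogPrimitive, negMulLog, hlog, hlog2]
  linear_combination (-1 / 6 + 2 / 3 * √2 * log (√2 + 1)) * hs

theorem statement18 :
    LG (fun x => 1 - (x ^ 2 - 1) ^ 2) =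
      -26 / 9 - 4 * Real.log 2 + 4 * Real.sqrt 2 * Real.log (Real.sqrt 2 + 1) := by
  unfold LG
  simp only
  rw [integral_sq_mul_log, integral_congr_Ioo_of_le zero_le_one
    (fun x hx => integral_log_difference hx), integral_mul_innerLogIntegral,
    outerPrimitive_one_sub_zero]
  ring
end
end
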